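/- arXiv:2505.18116 — 2 statements merged into one kernel-verified Lean document; each statement's English description precedes it below -/
import Mathlib

section
/- (Policy Optimization with Negative Answers.) Let A be a finite nonempty type, let π be a probability mass function on A, let p : A → ℝ satisfy 0 ≤ p(a) ≤ 1 for all a, set r_q := Σ_{a∈A} π(a)·p(a), and assume 0 < r_q < 1. Define π⁺(a) := π(a)·p(a)/r_q and π⁻(a) := π(a)·(1 − p(a))/(1 − r_q). Let q : A → ℝ satisfy q(a) ≥ 0 for all a, Σ_{a∈A} q(a) = 1, r_q·q(a) ≤ π(a) for all a, and π(a) − r_q·q(a) > 0 for every a with π⁻(a) > 0. Then the negative-data log-likelihood satisfies Σ_{a : π⁻(a)>0} π⁻(a) · log((π(a) − r_q·q(a))/(1 − r_q)) ≤ Σ_{a : π⁻(a)>0} π⁻(a) · log π⁻(a), and equality holds if and only if q(a) = π⁺(a) for all a ∈ A. -/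
/-- The Bregman form of Gibbs' inequality at a single point, with its equality case. -/
theorem mul_log_add_sub_le_mul_log {x y : ℝ} (hx : 0 ≤ x) (hy : 0 ≤ y) (hxy : 0 < x → 0 < y) :
    x * Real.log y + (x - y) ≤ x * Real.log x ∧
      (x * Real.log y + (x - y) = x * Real.log x ↔ y = x) := by
  rcases hx.eq_or_lt with rfl | hx
  · simpa using hy
  have hy := hxy hx
  have hlog : Real.log (y / x) = Real.log y - Real.log x := Real.log_div hy.ne' hx.ne'
  have hmul : x * (y / x - 1) = y - x := by field_simp
  refine ⟨?_, fun h => ?_, fun h => by simp [h]⟩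
  · have := mul_le_mul_of_nonneg_left (Real.log_le_sub_one_of_pos (div_pos hy hx)) hx.le
    rw [hlog, hmul] at this
    linarith
  · by_contra hne
    have hne' : y / x ≠ 1 := by rwa [ne_eq, div_eq_one_iff_eq hx.ne']
    have := mul_lt_mul_of_pos_left (Real.log_lt_sub_one_of_pos (div_pos hy hx) hne') hx
    rw [hlog, hmul] at this
    linarith

open Finset in
/-- Gibbs' inequality on a finite type, with its equality case. -/
theorem sum_mul_log_le_sum_mul_log {A : Type*} [Fintype A] {P Q : A → ℝ}
    (hP : ∀ a, 0 ≤ P a) (hQ : ∀ a, 0 ≤ Q a) (hPQ : ∀ a, 0 < P a → 0 < Q a)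
    (hsum : ∑ a, P a = ∑ a, Q a) :
    ∑ a, P a * Real.log (Q a) ≤ ∑ a, P a * Real.log (P a) ∧
      (∑ a, P a * Real.log (Q a) = ∑ a, P a * Real.log (P a) ↔ ∀ a, Q a = P a) := by
  have hpt a := mul_log_add_sub_le_mul_log (hP a) (hQ a) (hPQ a)
  have hshift : ∑ a, P a * Real.log (Q a) = ∑ a, (P a * Real.log (Q a) + (P a - Q a)) := by
    rw [sum_add_distrib, sum_sub_distrib, hsum, sub_self, add_zero]
  rw [hshift]
  refine ⟨sum_le_sum fun a _ => (hpt a).1, ?_⟩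
  rw [sum_eq_sum_iff_of_le fun a _ => (hpt a).1]
  simp [fun a => (hpt a).2]


open Finset in
/-- Policy Optimization with Negative Answers: among candidate positive policies `q`,
the negative-data log-likelihood of the implicit negative policy
`a ↦ (π a − r_q · q a)/(1 − r_q)` is maximized exactly at `q = π⁺`. -/
theorem policy_optimization_with_negative_answers
    {A : Type*} [Fintype A] [Nonempty A]
    (π : A → ℝ) (hπ0 : ∀ a, 0 ≤ π a) (hπ1 : ∑ a, π a = 1)
    (p : A → ℝ) (hp0 : ∀ a, 0 ≤ p a) (hp1 : ∀ a, p a ≤ 1)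
    (rq : ℝ) (hrq : rq = ∑ a, π a * p a) (hrq0 : 0 < rq) (hrq1 : rq < 1)
    (πpos πneg : A → ℝ)
    (hpos : ∀ a, πpos a = π a * p a / rq)
    (hneg : ∀ a, πneg a = π a * (1 - p a) / (1 - rq))
    (q : A → ℝ) (hq0 : ∀ a, 0 ≤ q a) (hq1 : ∑ a, q a = 1)
    (hdom : ∀ a, rq * q a ≤ π a)
    (hsupp : ∀ a, 0 < πneg a → 0 < π a - rq * q a) :
    (∑ a ∈ univ.filter (fun a => 0 < πneg a),
        πneg a * Real.log ((π a - rq * q a) / (1 - rq)))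
      ≤ (∑ a ∈ univ.filter (fun a => 0 < πneg a), πneg a * Real.log (πneg a)) ∧
    ((∑ a ∈ univ.filter (fun a => 0 < πneg a),
        πneg a * Real.log ((π a - rq * q a) / (1 - rq)))
      = (∑ a ∈ univ.filter (fun a => 0 < πneg a), πneg a * Real.log (πneg a))
      ↔ ∀ a, q a = πpos a) := by
  have h1 : 0 < 1 - rq := sub_pos.2 hrq1
  have hneg0 a : 0 ≤ πneg a := by
    rw [hneg]
    exact div_nonneg (mul_nonneg (hπ0 a) (sub_nonneg.2 (hp1 a))) h1.le
  have hsum : ∑ a, πneg a = ∑ a, (π a - rq * q a) / (1 - rq) := by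
    simp only [hneg, ← sum_div, mul_sub, mul_one, sum_sub_distrib, ← mul_sum, hq1, ← hrq]
  have hfilter (f : A → ℝ) :
      ∑ a ∈ univ.filter (fun a => 0 < πneg a), πneg a * f a = ∑ a, πneg a * f a :=
    sum_filter_of_ne fun a _ h => (hneg0 a).lt_of_ne' (left_ne_zero_of_mul h)
  rw [hfilter (fun a => Real.log ((π a - rq * q a) / (1 - rq))),
    hfilter (fun a => Real.log (πneg a))]
  obtain ⟨hle, heq⟩ := sum_mul_log_le_sum_mul_log hneg0
    (fun a => div_nonneg (sub_nonneg.2 (hdom a)) h1.le)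
    (fun a ha => div_pos (hsupp a ha) h1) hsum
  refine ⟨hle, heq.trans (forall_congr' fun a => ?_)⟩
  rw [hneg, hpos, div_left_inj' h1.ne', eq_div_iff hrq0.ne']
  constructor <;> intro h <;> linarith
end

section
/- (On-policy equivalence of NFT and GRPO, positive token.) Let r̂ ∈ (0, 1), 0 < ε ≤ 1, ε' ∈ (0, 1), and set ω := √((1 − r̂)/r̂) and A⁺ := √((1 − r̂)/r̂). Define the NFT positive-token loss L⁺_NFT(R) := −ω·log R and the GRPO positive-token loss L⁺_GRPO(R) := −min(R·A⁺, clip(R, 1 − ε', 1 + ε')·A⁺), where clip(R, l, u) := max(l, min(R, u)). Then both L⁺_NFT and L⁺_GRPO have derivative −A⁺ at R = 1; in particular their derivatives at R = 1 coincide. -/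
/-- On-policy equivalence of NFT and GRPO, positive token: both the NFT positive-token
loss `−ω·log R` and the GRPO positive-token loss `−min(R·A⁺, clip(R,1−ε',1+ε')·A⁺)`
have derivative `−A⁺` at `R = 1`. -/
theorem nft_grpo_onpolicy_equivalence_positive (rhat ε ε' : ℝ)
    (h1 : 0 < rhat) (h2 : rhat < 1)
    (hε0 : 0 < ε) (hε1 : ε ≤ 1) (hε'0 : 0 < ε') (hε'1 : ε' < 1)
    (ω Aplus : ℝ)
    (hω : ω = Real.sqrt ((1 - rhat) / rhat))
    (hA : Aplus = Real.sqrt ((1 - rhat) / rhat)) :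
    HasDerivAt (fun R : ℝ => -(ω * Real.log R)) (-Aplus) 1 ∧
    HasDerivAt (fun R : ℝ =>
      -(min (R * Aplus) (max (1 - ε') (min R (1 + ε')) * Aplus))) (-Aplus) 1 := by
  subst hω hA
  constructor
  · simpa using ((Real.hasDerivAt_log one_ne_zero).const_mul √((1 - rhat) / rhat)).fun_neg
  · have h_lin : HasDerivAt (fun R : ℝ => -(R * √((1 - rhat) / rhat)))
        (-√((1 - rhat) / rhat)) 1 := by
      simpa using ((hasDerivAt_id (1 : ℝ)).mul_const √((1 - rhat) / rhat)).fun_neg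
    refine h_lin.congr_of_eventuallyEq ?_
    filter_upwards [Ioo_mem_nhds (show 1 - ε' < 1 by linarith) (show 1 < 1 + ε' by linarith)]
      with R hR
    rw [min_eq_left hR.2.le, max_eq_right hR.1.le, min_self]
end
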